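/- arXiv:1105.2003 — 2 statements merged into one kernel-verified Lean document; each statement's English description precedes it below -/
import Mathlib

section
/- Let p be a prime and let m, j be natural numbers with 1 ≤ m ≤ j < p. Let a : {0,…,m−1} → 𝔽_p and let f ∈ 𝔽_p[X] be the unique polynomial of degree less than m with f(i) = a_i for every i ∈ {0,…,m−1}. Then, computing in 𝔽_p, f(j) = h(j) · Σ_{i=0}^{m−1} b(i) · (j − i)^{−1}, where b(i) = a_i · ∏_{x ∈ {0,…,m−1}, x ≠ i} (i − x)^{−1} and h(j) = ∏_{k=j+1−m}^{j} k. (All the inverses exist because 0 < |x − i| < m ≤ p for x ≠ i and 0 < j − i < p for i < m ≤ j < p.) -/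
/-- A product of consecutive naturals ending at `j`, written with the factors `j - x`. -/
theorem prod_range_natCast_sub {R : Type*} [CommRing R] {m j : ℕ} (hmj : m ≤ j) :
    ∏ x ∈ Finset.range m, ((j : R) - (x : R)) = ∏ k ∈ Finset.Icc (j + 1 - m) j, (k : R) := by
  refine Finset.prod_bij' (fun x _ => j - x) (fun k _ => j - k) ?_ ?_ ?_ ?_ ?_
  all_goals intro x hx; simp only [Finset.mem_range, Finset.mem_Icc] at hx ⊢
  · omega
  · omega
  · omega
  · omega
  · rw [Nat.cast_sub (by omega)]

/-- The natural numbers below `p` are distinct modulo `p`. -/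
theorem ZMod.natCast_injOn_Iio (p : ℕ) : Set.InjOn (Nat.cast : ℕ → ZMod p) (Set.Iio p) := by
  intro x hx y hy hxy
  exact ((ZMod.natCast_eq_natCast_iff x y p).1 hxy).eq_of_lt_of_lt hx hy

/-- Evaluating the low-degree extension `f` of data `a : {0,…,m-1} → 𝔽_p`
at a point `j` outside the interpolation range as a scaled convolution:
`f(j) = h(j) · ∑_i b(i) · (j − i)⁻¹` where
`b(i) = a_i · ∏_{x ≠ i} (i − x)⁻¹` and `h(j) = ∏_{k=j+1−m}^{j} k`. -/
theorem stmt_1 (p : ℕ) [Fact p.Prime] (m j : ℕ) (hm : 1 ≤ m) (hmj : m ≤ j)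
    (hjp : j < p) (a : Fin m → ZMod p) (f : Polynomial (ZMod p))
    (hdeg : f.degree < m)
    (hint : ∀ i : Fin m, f.eval ((i : ℕ) : ZMod p) = a i) :
    f.eval ((j : ZMod p)) =
      (∏ k ∈ Finset.Icc (j + 1 - m) j, (k : ZMod p)) *
        ∑ i : Fin m,
          (a i * ∏ x ∈ (Finset.range m).erase (i : ℕ),
              (((i : ℕ) : ZMod p) - ((x : ℕ) : ZMod p))⁻¹) *
            ((j : ZMod p) - ((i : ℕ) : ZMod p))⁻¹ := by
  have hinj : Set.InjOn (Nat.cast : ℕ → ZMod p) (Finset.range m) :=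
    (ZMod.natCast_injOn_Iio p).mono fun x hx => by
      have := Finset.mem_range.1 hx
      simp only [Set.mem_Iio]
      omega
  have hj : ∀ i ∈ Finset.range m, (j : ZMod p) ≠ (i : ZMod p) := by
    intro i hi h
    have hi' := Finset.mem_range.1 hi
    have := ZMod.natCast_injOn_Iio p hjp (hi'.trans_le (hmj.trans hjp.le)) h
    omega
  have hf := Lagrange.eq_interpolate hinj (f := f) (by simpa using hdeg)
  rw [hf, Lagrange.eval_interpolate_not_at_node _ hj, Lagrange.eval_nodal,
    prod_range_natCast_sub hmj, Finset.sum_range]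
  congr 1
  refine Finset.sum_congr rfl fun i _ => ?_
  rw [hint i, Lagrange.nodalWeight]
  ring
end

section
/- Let t : {0,…,n−1} → ℕ be a text and pat : {0,…,q−1} → ℕ a pattern, where the value 0 represents the wildcard symbol. Fix a location i with i + q ≤ n. Then, computing over the integers, Σ_{j=0}^{q−1} t_{i+j} · pat_j · (t_{i+j} − pat_j)² = 0 if and only if for every j ∈ {0,…,q−1}, either pat_j = 0, or t_{i+j} = 0, or pat_j = t_{i+j} (i.e., the pattern occurs at location i). -/
/-- Correctness of the PMwW arithmetization: for a text `t` and pattern `pat`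
over ℕ with `0` encoding the wildcard, and a location `i` with `i + q ≤ n`,
the integer sum `∑_{j<q} t_{i+j}·pat_j·(t_{i+j} − pat_j)²` vanishes iff the
pattern occurs at location `i` (at every position, either one of the symbols is
a wildcard, or the symbols agree). -/
theorem stmt_4 (n q i : ℕ) (t : Fin n → ℕ) (pat : Fin q → ℕ) (h : i + q ≤ n) :
    (∑ j : Fin q,
        (t ⟨i + j, by have := j.isLt; omega⟩ : ℤ) * (pat j : ℤ) *
          ((t ⟨i + j, by have := j.isLt; omega⟩ : ℤ) - (pat j : ℤ)) ^ 2) = 0 ↔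
      ∀ j : Fin q, pat j = 0 ∨ t ⟨i + j, by have := j.isLt; omega⟩ = 0 ∨
        pat j = t ⟨i + j, by have := j.isLt; omega⟩ := by
  rw [Finset.sum_eq_zero_iff_of_nonneg fun j _ => by positivity]
  simp only [Finset.mem_univ, forall_const, mul_eq_zero, Nat.cast_eq_zero,
    pow_eq_zero_iff two_ne_zero, sub_eq_zero, Nat.cast_inj]
  refine forall_congr' fun j => ?_
  rw [or_assoc, or_left_comm, eq_comm (b := pat j)]
end
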